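/- Let (q_n) be a sequence of elements of Ω₂ such that the sequence (T(q_n), T(C ∖ q_n)) converges in (Set W) × (Set W) with the topology of pointwise convergence. Then for each f in Thompson's group F, the sequence (T(f · q_n), T(C ∖ (f · q_n))) also converges in (Set W) × (Set W). -/

import Mathlib

open Set MeasureTheory Filter Topology

/-- The binary Cantor space. -/
abbrev CantorC : Type := ℕ → Bool

/-- Finite binary words. -/
abbrev BWord : Type := List Bool

/-- Prepend a finite word to an infinite binary sequence. -/
def wordApp (w : BWord) (x : CantorC) : CantorC := fun n =>
  if h : n < w.length then w.get ⟨n, h⟩ else x (n - w.length)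

/-- The cylinder of sequences beginning with the word `w`. -/
def cyl (w : BWord) : Set CantorC := Set.range (wordApp w)

/-- `J` is a code: both the α-cylinders and the β-cylinders form a partition of the
Cantor space (every point lies in the cylinder of exactly one pair). -/
def IsCode (J : Finset (BWord × BWord)) : Prop :=
  (∀ x : CantorC, ∃! p : BWord × BWord, p ∈ J ∧ x ∈ cyl p.1) ∧
  (∀ x : CantorC, ∃! p : BWord × BWord, p ∈ J ∧ x ∈ cyl p.2)

/-- `J` is order preserving: α ≺ α' lexicographically iff β ≺ β' lexicographically. -/
def OrdPres (J : Finset (BWord × BWord)) : Prop :=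
  ∀ p ∈ J, ∀ q ∈ J, (List.Lex (· < ·) p.1 q.1 ↔ List.Lex (· < ·) p.2 q.2)

/-- The bijection `g` is induced by the code `J` : it maps `β·x` to `α·x`. -/
def InducedBy (J : Finset (BWord × BWord)) (g : Equiv.Perm CantorC) : Prop :=
  ∀ p ∈ J, ∀ x : CantorC, g (wordApp p.2 x) = wordApp p.1 x

/-- `J` is an order-preserving code inducing the bijection `g`. -/
def IsCodeFor (J : Finset (BWord × BWord)) (g : Equiv.Perm CantorC) : Prop :=
  IsCode J ∧ OrdPres J ∧ InducedBy J g

/-- Membership in (the realization on the Cantor space of) Thompson's group `F`. -/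
def InF (g : Equiv.Perm CantorC) : Prop := ∃ J, IsCodeFor J g

/-- The pair `(α, β)` has `|α| ≡ |β| (mod 2)`. -/
def EvenPair (p : BWord × BWord) : Prop := p.1.length % 2 = p.2.length % 2

/-- Membership in the subgroup `H₂` : some order-preserving code for `g` has all
pairs of even length difference. -/
def InH2 (g : Equiv.Perm CantorC) : Prop :=
  ∃ J, IsCodeFor J g ∧ ∀ p ∈ J, EvenPair p

/-- The union of the α-cylinders over pairs of even length difference. -/
def pSet (J : Finset (BWord × BWord)) : Set CantorC :=
  {x | ∃ p ∈ J, EvenPair p ∧ x ∈ cyl p.1}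

/-- The union of the β-cylinders over pairs of even length difference. -/
def eSet (J : Finset (BWord × BWord)) : Set CantorC :=
  {x | ∃ p ∈ J, EvenPair p ∧ x ∈ cyl p.2}

/-- `p_f` : for `f ∈ F` this equals `pSet J` for any (equivalently, every)
order-preserving code `J` for `f`. -/
def pF (g : Equiv.Perm CantorC) : Set CantorC :=
  ⋃ J ∈ {J : Finset (BWord × BWord) | IsCodeFor J g}, pSet J

/-- `E_f` : for `f ∈ F` this equals `eSet J` for any (equivalently, every)
order-preserving code `J` for `f`. -/
def EF (g : Equiv.Perm CantorC) : Set CantorC :=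
  ⋃ J ∈ {J : Finset (BWord × BWord) | IsCodeFor J g}, eSet J

/-- `Ω₂ = {p_f : f ∈ F}`. -/
def Omega2 : Set (Set CantorC) := {p | ∃ g, InF g ∧ pF g = p}

/-- The action `f · p = f(p ∩ E_f) ∪ f((C ∖ p) ∩ (C ∖ E_f))`. -/
def actF (g : Equiv.Perm CantorC) (p : Set CantorC) : Set CantorC :=
  g '' (p ∩ EF g) ∪ g '' (pᶜ ∩ (EF g)ᶜ)

open Classical in
/-- `T(p)` as a Boolean-valued characteristic function: `T(p) w = true` iff the
cylinder of `w` meets `p`. -/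
noncomputable def Tb (p : Set CantorC) : BWord → Bool :=
  fun w => if (cyl w ∩ p).Nonempty then true else false

/-- The embedding `p ↦ (T(p), T(C ∖ p))`. -/
noncomputable def embedT (p : Set CantorC) : (BWord → Bool) × (BWord → Bool) :=
  (Tb p, Tb pᶜ)

/-- `Ω̄₂` : the closure of the image of `Ω₂` under the embedding. -/
noncomputable def OmegaBar : Set ((BWord → Bool) × (BWord → Bool)) :=
  closure (embedT '' Omega2)

theorem wordApp_nil (z : CantorC) : wordApp [] z = z := by
  funext n
  simp [wordApp]

theorem wordApp_cons_zero (a : Bool) (w : BWord) (z : CantorC) : wordApp (a :: w) z 0 = a := by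
  simp [wordApp]

theorem wordApp_cons_succ (a : Bool) (w : BWord) (z : CantorC) (n : ℕ) :
    wordApp (a :: w) z (n + 1) = wordApp w z n := by
  simp [wordApp]

theorem wordApp_cons_inj {a b : Bool} {v w : BWord} {y z : CantorC} :
    wordApp (a :: v) y = wordApp (b :: w) z ↔ a = b ∧ wordApp v y = wordApp w z := by
  constructor
  · intro h
    refine ⟨by simpa [wordApp_cons_zero] using congrFun h 0, funext fun n => ?_⟩
    simpa [wordApp_cons_succ] using congrFun h (n + 1)
  · rintro ⟨rfl, h⟩
    funext n
    cases n with
    | zero => simp [wordApp_cons_zero]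
    | succ n => simp [wordApp_cons_succ, h]

theorem wordApp_append (v w : BWord) (z : CantorC) :
    wordApp (v ++ w) z = wordApp v (wordApp w z) := by
  induction v with
  | nil => rw [wordApp_nil, List.nil_append]
  | cons a v ih => exact wordApp_cons_inj.2 ⟨rfl, ih⟩

theorem wordApp_injective (w : BWord) : Function.Injective (wordApp w) := by
  induction w with
  | nil => intro y z h; simpa [wordApp_nil] using h
  | cons a w ih => exact fun y z h => ih (wordApp_cons_inj.1 h).2

/-- Words acting identically on all sequences have the same length. -/
theorem length_eq_of_wordApp_eq {v w : BWord} (h : ∀ z, wordApp v z = wordApp w z) :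
    v.length = w.length := by
  induction v generalizing w with
  | nil =>
    cases w with
    | nil => rfl
    | cons b w =>
      have := congrFun (h fun _ => !b) 0
      simp [wordApp_nil, wordApp_cons_zero] at this
  | cons a v ih =>
    cases w with
    | nil =>
      have := congrFun (h fun _ => !a) 0
      simp [wordApp_nil, wordApp_cons_zero] at this
    | cons b w =>
      simpa using ih fun z => (wordApp_cons_inj.1 (h z)).2

/-- Two words with intersecting cylinders are comparable for the prefix order. -/
theorem exists_append_of_wordApp_eq {v w : BWord} {y z : CantorC}
    (h : wordApp v y = wordApp w z) : (∃ u, w = v ++ u) ∨ ∃ u, v = w ++ u := by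
  induction v generalizing w with
  | nil => exact Or.inl ⟨w, rfl⟩
  | cons a v ih =>
    cases w with
    | nil => exact Or.inr ⟨a :: v, rfl⟩
    | cons b w =>
      obtain ⟨rfl, hvw⟩ := wordApp_cons_inj.1 h
      rcases ih hvw with ⟨u, rfl⟩ | ⟨u, rfl⟩
      · exact Or.inl ⟨u, rfl⟩
      · exact Or.inr ⟨u, rfl⟩

/-- The preimage of a cylinder under prepending a word is a cylinder or empty. -/
theorem preimage_wordApp_cyl (v w : BWord) :
    (∃ u, wordApp v ⁻¹' cyl w = cyl u) ∨ wordApp v ⁻¹' cyl w = ∅ := by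
  by_cases h : ∃ y z, wordApp v y = wordApp w z
  · left
    obtain ⟨y, z, h⟩ := h
    rcases exists_append_of_wordApp_eq h with ⟨u, rfl⟩ | ⟨u, rfl⟩
    · refine ⟨u, ?_⟩
      ext x
      simp [cyl, wordApp_append, (wordApp_injective v).eq_iff]
    · refine ⟨[], ?_⟩
      ext x
      simp [cyl, wordApp_append, wordApp_nil]
  · right
    refine Set.eq_empty_of_forall_notMem fun y hy => h ?_
    obtain ⟨z, hz⟩ := hy
    exact ⟨y, z, hz.symm⟩

theorem evenPair_of_append {f : CantorC → CantorC} {p q : BWord × BWord} {u : BWord}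
    (hp : ∀ x, f (wordApp p.2 x) = wordApp p.1 x) (hq : ∀ x, f (wordApp q.2 x) = wordApp q.1 x)
    (h : q.2 = p.2 ++ u) : EvenPair p ↔ EvenPair q := by
  have hlen : (p.1 ++ u).length = q.1.length := length_eq_of_wordApp_eq fun z => by
    rw [wordApp_append, ← hp, ← wordApp_append, ← h, hq]
  have hlen' := congrArg List.length h
  simp only [List.length_append] at hlen hlen'
  unfold EvenPair
  omega

theorem wordApp_mem_EF_iff {f : Equiv.Perm CantorC} {J : Finset (BWord × BWord)}
    (hJ : IsCodeFor J f) {p : BWord × BWord} (hp : p ∈ J) (z : CantorC) :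
    wordApp p.2 z ∈ EF f ↔ EvenPair p := by
  constructor
  · intro h
    simp only [EF, Set.mem_iUnion, Set.mem_ofPred_eq, eSet] at h
    obtain ⟨K, hK, q, hq, hev, y, hy⟩ := h
    rcases exists_append_of_wordApp_eq hy with ⟨u, hu⟩ | ⟨u, hu⟩
    · exact (evenPair_of_append (hK.2.2 q hq) (hJ.2.2 p hp) hu).1 hev
    · exact (evenPair_of_append (hJ.2.2 p hp) (hK.2.2 q hq) hu).2 hev
  · intro h
    simp only [EF, Set.mem_iUnion, Set.mem_ofPred_eq, eSet]
    exact ⟨J, hJ, p, hp, h, z, rfl⟩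

theorem apply_mem_actF_iff (f : Equiv.Perm CantorC) (p : Set CantorC) (x : CantorC) :
    f x ∈ actF f p ↔ (x ∈ p ↔ x ∈ EF f) := by
  simp only [actF, Set.mem_union, f.injective.mem_set_image, Set.mem_inter_iff, Set.mem_compl_iff]
  tauto

theorem compl_actF (f : Equiv.Perm CantorC) (p : Set CantorC) :
    (actF f p)ᶜ = actF f pᶜ := by
  ext x
  obtain ⟨y, rfl⟩ := f.surjective x
  simp only [Set.mem_compl_iff, apply_mem_actF_iff]
  tauto

theorem cyl_inter_actF_nonempty_iff {f : Equiv.Perm CantorC} {J : Finset (BWord × BWord)}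
    (hJ : IsCodeFor J f) (p : Set CantorC) (w : BWord) :
    (cyl w ∩ actF f p).Nonempty ↔
      ∃ r ∈ J, ∃ z ∈ wordApp r.1 ⁻¹' cyl w, (wordApp r.2 z ∈ p ↔ EvenPair r) := by
  have key : ∀ r ∈ J, ∀ z, wordApp r.1 z ∈ actF f p ↔ (wordApp r.2 z ∈ p ↔ EvenPair r) := by
    intro r hr z
    rw [← hJ.2.2 r hr, apply_mem_actF_iff, wordApp_mem_EF_iff hJ hr]
  constructor
  · rintro ⟨x, hxw, hx⟩
    obtain ⟨r, ⟨hr, z, rfl⟩, -⟩ := hJ.1.1 x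
    exact ⟨r, hr, z, hxw, (key r hr z).1 hx⟩
  · rintro ⟨r, hr, z, hzw, hz⟩
    exact ⟨wordApp r.1 z, hzw, (key r hr z).2 hz⟩

/-- A sequence of propositions is eventually constant. -/
def EventuallyDecided (P : ℕ → Prop) : Prop :=
  (∀ᶠ n in atTop, P n) ∨ ∀ᶠ n in atTop, ¬ P n

theorem EventuallyDecided.exists_mem {ι : Type*} (J : Finset ι) {P : ι → ℕ → Prop}
    (h : ∀ r ∈ J, EventuallyDecided (P r)) : EventuallyDecided fun n => ∃ r ∈ J, P r n := by
  by_cases hex : ∃ r ∈ J, ∀ᶠ n in atTop, P r n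
  · obtain ⟨r, hr, hev⟩ := hex
    exact Or.inl (hev.mono fun n hn => ⟨r, hr, hn⟩)
  · right
    have : ∀ r ∈ J, ∀ᶠ n in atTop, ¬ P r n := fun r hr =>
      (h r hr).resolve_left fun hev => hex ⟨r, hr, hev⟩
    filter_upwards [(Filter.eventually_all_finset J).2 this] with n hn
    rintro ⟨r, hr, hP⟩
    exact hn r hr hP

theorem exists_tendsto_Tb_iff (p : ℕ → Set CantorC) :
    (∃ x, Tendsto (fun n => Tb (p n)) atTop (nhds x)) ↔
      ∀ w, EventuallyDecided fun n => (cyl w ∩ p n).Nonempty := by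
  simp only [tendsto_pi_nhds, nhds_discrete, tendsto_pure]
  constructor
  · rintro ⟨x, hx⟩ w
    cases hb : x w with
    | true => exact Or.inl ((hx w).mono fun n hn => by simpa [Tb, hb] using hn)
    | false =>
      refine Or.inr ((hx w).mono fun n hn => ?_)
      intro hne
      simp [Tb, hb, hne] at hn
  · intro h
    have : ∀ w, ∃ b, ∀ᶠ n in atTop, Tb (p n) w = b := fun w => by
      rcases h w with h | h
      · exact ⟨true, h.mono fun n hn => if_pos hn⟩
      · exact ⟨false, h.mono fun n hn => if_neg hn⟩
    choose x hx using this
    exact ⟨x, hx⟩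

theorem exists_tendsto_embedT_iff (p : ℕ → Set CantorC) :
    (∃ x, Tendsto (fun n => embedT (p n)) atTop (nhds x)) ↔
      (∀ w, EventuallyDecided fun n => (cyl w ∩ p n).Nonempty) ∧
        ∀ w, EventuallyDecided fun n => (cyl w ∩ (p n)ᶜ).Nonempty := by
  rw [← exists_tendsto_Tb_iff, ← exists_tendsto_Tb_iff]
  constructor
  · rintro ⟨x, hx⟩
    exact ⟨⟨x.1, hx.fst_nhds⟩, ⟨x.2, hx.snd_nhds⟩⟩
  · rintro ⟨⟨x, hx⟩, ⟨y, hy⟩⟩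
    exact ⟨(x, y), hx.prodMk_nhds hy⟩

theorem eventuallyDecided_actF {f : Equiv.Perm CantorC} (hf : InF f) {p : ℕ → Set CantorC}
    (h : ∀ w, EventuallyDecided fun n => (cyl w ∩ p n).Nonempty)
    (hc : ∀ w, EventuallyDecided fun n => (cyl w ∩ (p n)ᶜ).Nonempty) (w : BWord) :
    EventuallyDecided fun n => (cyl w ∩ actF f (p n)).Nonempty := by
  obtain ⟨J, hJ⟩ := hf
  simp only [cyl_inter_actF_nonempty_iff hJ]
  refine EventuallyDecided.exists_mem J fun r _ => ?_
  rcases preimage_wordApp_cyl r.1 w with ⟨u, hu⟩ | hu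
  · have hcyl : ∀ s : Set CantorC,
        (cyl (r.2 ++ u) ∩ s).Nonempty ↔ ∃ z ∈ cyl u, wordApp r.2 z ∈ s := fun s => by
      simp [Set.Nonempty, cyl, wordApp_append]
    rw [hu]
    by_cases hr : EvenPair r
    · simpa only [hcyl, hr, iff_true] using h (r.2 ++ u)
    · simpa only [hcyl, hr, iff_false, Set.mem_compl_iff] using hc (r.2 ++ u)
  · rw [hu]
    exact Or.inr (Eventually.of_forall fun n => by simp)

/-- if `(q_n) ⊆ Ω₂` and `(T(q_n), T(C∖q_n))` converges in
`(BWord → Bool) × (BWord → Bool)` (pointwise convergence), then for each `f ∈ F`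
the sequence `(T(f·q_n), T(C∖(f·q_n)))` converges as well. -/
theorem stmt13 (q : ℕ → Set CantorC) (hq : ∀ n, q n ∈ Omega2)
    (hconv : ∃ x, Tendsto (fun n => embedT (q n)) atTop (nhds x))
    (f : Equiv.Perm CantorC) (hf : InF f) :
    ∃ y, Tendsto (fun n => embedT (actF f (q n))) atTop (nhds y) := by
  rw [exists_tendsto_embedT_iff] at hconv ⊢
  refine ⟨eventuallyDecided_actF hf hconv.1 hconv.2, ?_⟩
  simp only [compl_actF]
  exact eventuallyDecided_actF hf hconv.2 (by simpa only [compl_compl] using hconv.1)
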